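/- Let A ⊆ P(I) be a finite poset under inclusion in which every chain has length at most 1, let H_c : E_c → ℝ (c ∈ A) be Hamiltonians, let a ∈ A be a colinear point with witness a↓, and set B = A∖{a}. Define Ĥ_{a↓}(x) = ln Σ_{z∈E_a, z_{a↓} = x} e^{−H_a(z) + H_{a↓}(x)} for x ∈ E_{a↓}, and define Hamiltonians H̃ on B as follows: (Case 1) if a↓ is a linear point of B with witness b↑, set H̃_c = H_c for all c ∈ B with c ≠ b↑ and H̃_{b↑}(x) = H_{b↑}(x) − Ĥ_{a↓}(x_{a↓}) for x ∈ E_{b↑}; (Case 2) if a↓ is not a linear point of B, then c_B(a↓) ≠ 0, and set H̃_c = H_c for all c ∈ B with c ≠ a↓ and H̃_{a↓}(x) = H_{a↓}(x) − Ĥ_{a↓}(x)/c_B(a↓) for x ∈ E_{a↓}. Let ψ : L(B) → L(A) be defined by ψ(Q)_b = Q_b for b ≠ a and ψ(Q)_a(x) = Q_{a↓}(x_{a↓}) · e^{−H_a(x)} / Σ_{z∈E_a, z_{a↓} = x_{a↓}} e^{−H_a(z)}. Then ψ restricts to a bijection between the global minimizers of BT_{B,H̃} over L(B) and the global minimizers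 of BT_{A,H} over L(A), and to a bijection between the critical points of BT_{B,H̃} in L(B)° and the critical points of BT_{A,H} in L(A)°. -/

import Mathlib

/- Setup: `I` a finite index set, `E i` nonempty finite sets of values, `A : Finset (Finset I)`
a collection of subsets of `I` ordered by inclusion.  For `a : Finset I`,
`Ea E a = ∏_{i ∈ a} E i`, with coordinate projections `proj`.  A family of "local functions"
indexed by `A` is an element of `Fam E A`. -/

abbrev Ea {I : Type} (E : I → Type) (a : Finset I) : Type := (i : a) → E i

def proj {I : Type} (E : I → Type) {a b : Finset I} (h : b ⊆ a) (x : Ea E a) : Ea E b :=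
  fun i => x ⟨i, h i.2⟩

abbrev Fam {I : Type} (E : I → Type) (A : Finset (Finset I)) : Type :=
  (a : A) → Ea E (a : Finset I) → ℝ

-- The local polytope `L(A)`: families of probability distributions compatible by marginalization.
open Classical in
def MemL {I : Type} (E : I → Type) [∀ i, Fintype (E i)] (A : Finset (Finset I))
    (Q : Fam E A) : Prop :=
  (∀ a : A, (∀ x, 0 ≤ Q a x) ∧ (∑ x, Q a x) = 1) ∧
  (∀ (a b : A) (h : (b : Finset I) ⊆ (a : Finset I)) (x : Ea E (b : Finset I)),
    Q b x = ∑ y ∈ Finset.univ.filter (fun y : Ea E (a : Finset I) => proj E h y = x), Q a y)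

-- The interior `L(A)°`: members of `L(A)` with all distributions strictly positive.
def MemLInt {I : Type} (E : I → Type) [∀ i, Fintype (E i)] (A : Finset (Finset I))
    (Q : Fam E A) : Prop :=
  MemL E A Q ∧ ∀ (a : A) (x : Ea E (a : Finset I)), 0 < Q a x

-- The tangent space `TL(A)` of the local polytope.
open Classical in
def MemT {I : Type} (E : I → Type) [∀ i, Fintype (E i)] (A : Finset (Finset I))
    (u : Fam E A) : Prop :=
  (∀ a : A, (∑ x, u a x) = 0) ∧
  (∀ (a b : A) (h : (b : Finset I) ⊆ (a : Finset I)) (x : Ea E (b : Finset I)),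
    u b x = ∑ y ∈ Finset.univ.filter (fun y : Ea E (a : Finset I) => proj E h y = x), u a y)

-- `μ` is the Möbius function of the poset `A` (ordered by inclusion): `μ x y = 0` for
-- `x, y ∈ A` with `¬ y ⊆ x`, and `∑_{b ∈ A, c ⊆ b ⊆ a} μ b c = δ_{a,c}` for `c ⊆ a` in `A`.
open Classical in
def IsMobius {I : Type} (A : Finset (Finset I)) (μ : Finset I → Finset I → ℤ) : Prop :=
  (∀ x ∈ A, ∀ y ∈ A, ¬ y ⊆ x → μ x y = 0) ∧
  (∀ a ∈ A, ∀ c ∈ A, c ⊆ a →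
    (∑ b ∈ A.filter (fun b => c ⊆ b ∧ b ⊆ a), μ b c) = if a = c then 1 else 0)

-- `c_A(x) = ∑_{b ∈ A, b ⊇ x} μ_A(b, x)`.
open Classical in
noncomputable def coefC {I : Type} (A : Finset (Finset I)) (μ : Finset I → Finset I → ℤ)
    (x : Finset I) : ℤ :=
  ∑ b ∈ A.filter (fun b => x ⊆ b), μ b x

-- Shannon entropy `S(Q) = −∑_x Q x ln (Q x)` (with `0 ln 0 = 0`, as `Real.log 0 = 0`).
noncomputable def entropy {α : Type*} [Fintype α] (Q : α → ℝ) : ℝ :=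
  -∑ x, Q x * Real.log (Q x)

-- The generalized Bethe free energy
-- `BT_{A,H}(Q) = ∑_{a ∈ A} c_A(a) (∑_x Q_a(x) H_a(x) − S(Q_a))`.
open Classical in
noncomputable def BT {I : Type} (E : I → Type) [∀ i, Fintype (E i)]
    (A : Finset (Finset I)) (μ : Finset I → Finset I → ℤ)
    (H : (c : Finset I) → Ea E c → ℝ) (Q : Fam E A) : ℝ :=
  ∑ a : A, (coefC A μ (a : Finset I) : ℝ) *
    ((∑ x, Q a x * H (a : Finset I) x) - entropy (Q a))

-- A critical point of a functional `F` on `L(A)°`: a point `Q ∈ L(A)°` at which the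
-- derivative at `t = 0` of `t ↦ F(Q + t u)` vanishes for every tangent vector `u ∈ TL(A)`.
open Classical in
def IsCritical {I : Type} (E : I → Type) [∀ i, Fintype (E i)]
    (A : Finset (Finset I)) (F : Fam E A → ℝ) (Q : Fam E A) : Prop :=
  MemLInt E A Q ∧
  ∀ u : Fam E A, MemT E A u →
    deriv (fun t : ℝ => F (fun a x => Q a x + t * u a x)) 0 = 0

-- A global minimizer of `F` over `L(A)`.
def IsMinimizer {I : Type} (E : I → Type) [∀ i, Fintype (E i)]
    (A : Finset (Finset I)) (F : Fam E A → ℝ) (Q : Fam E A) : Prop :=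
  MemL E A Q ∧ ∀ Q' : Fam E A, MemL E A Q' → F Q ≤ F Q'

-- Every chain of `A` has length at most 1: there is no chain `x ⊂ y ⊂ z` in `A`.
def ChainsShort {I : Type} (A : Finset (Finset I)) : Prop :=
  ∀ x ∈ A, ∀ y ∈ A, ∀ z ∈ A, x ⊂ y → y ⊂ z → False

-- For a colinear point `a ∈ A` with witness `aDn`, the map `ψ : L(A∖{a}) → L(A)`:
-- `ψ(Q)_b = Q_b` for `b ≠ a`, and
-- `ψ(Q)_a(x) = Q_{aDn}(x_{aDn}) e^{−H_a(x)} / ∑_{z ∈ E_a, z_{aDn} = x_{aDn}} e^{−H_a(z)}`.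
open Classical in
noncomputable def psiMap {I : Type} [DecidableEq I] (E : I → Type) [∀ i, Fintype (E i)]
    (A : Finset (Finset I)) (a aDn : Finset I) (hsub : aDn ⊆ a) (hDn : aDn ∈ A.erase a)
    (H : (c : Finset I) → Ea E c → ℝ) (Q : Fam E (A.erase a)) : Fam E A :=
  fun c x =>
    if h : (c : Finset I) = a then
      have hsub' : aDn ⊆ (c : Finset I) := by rw [h]; exact hsub
      Q ⟨aDn, hDn⟩ (fun i => x ⟨i, hsub' i.2⟩) * Real.exp (-(H (c : Finset I) x)) /
        ∑ z ∈ Finset.univ.filter (fun z : Ea E (c : Finset I) =>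
            ∀ i : {w // w ∈ aDn}, z ⟨i, hsub' i.2⟩ = x ⟨i, hsub' i.2⟩),
          Real.exp (-(H (c : Finset I) z))
    else Q ⟨c, Finset.mem_erase.2 ⟨h, c.2⟩⟩ x

-- `Ĥ_{aDn}(x) = ln ∑_{z ∈ E_a, z_{aDn} = x} e^{−H_a(z) + H_{aDn}(x)}`.
open Classical in
noncomputable def Hhat {I : Type} [DecidableEq I] (E : I → Type) [∀ i, Fintype (E i)]
    (a aDn : Finset I) (hsub : aDn ⊆ a) (H : (c : Finset I) → Ea E c → ℝ)
    (x : Ea E aDn) : ℝ :=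
  Real.log (∑ z ∈ Finset.univ.filter (fun z : Ea E a =>
      ∀ i : {w // w ∈ aDn}, z ⟨i, hsub i.2⟩ = x i),
    Real.exp (-(H a z) + H aDn x))

section Helpers

variable {I : Type} (E : I → Type) [∀ i, Fintype (E i)]

open Classical in
def Marg (A : Finset (Finset I)) (u : Fam E A) : Prop :=
  (∀ (a b : A) (h : (b : Finset I) ⊆ (a : Finset I)) (x : Ea E (b : Finset I)),
    u b x = ∑ y ∈ Finset.univ.filter (fun y : Ea E (a : Finset I) => proj E h y = x), u a y)

open Classical in
noncomputable def ZZ (a aDn : Finset I) (hsub : aDn ⊆ a) (H : (c : Finset I) → Ea E c → ℝ)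
    (y : Ea E aDn) : ℝ :=
  ∑ z ∈ Finset.univ.filter (fun z : Ea E a => proj E hsub z = y), Real.exp (-(H a z))

open Classical in
lemma proj_surj [∀ i, Nonempty (E i)] {a b : Finset I} (hsub : b ⊆ a) (y : Ea E b) :
    ∃ z : Ea E a, proj E hsub z = y := by
  refine ⟨fun i => if h : (i : I) ∈ b then y ⟨i, h⟩ else Classical.arbitrary _, ?_⟩
  funext i
  simp [proj]

lemma ZZ_pos [∀ i, Nonempty (E i)] (a aDn : Finset I) (hsub : aDn ⊆ a)
    (H : (c : Finset I) → Ea E c → ℝ) (y : Ea E aDn) : 0 < ZZ E a aDn hsub H y := by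
  obtain ⟨z, hz⟩ := proj_surj E hsub y
  exact Finset.sum_pos (fun _ _ => Real.exp_pos _) ⟨z, by simp [hz]⟩

open Classical in
lemma Hhat_eq [∀ i, Nonempty (E i)] (a aDn : Finset I) (hsub : aDn ⊆ a)
    (H : (c : Finset I) → Ea E c → ℝ) (y : Ea E aDn) :
    Hhat E a aDn hsub H y = Real.log (ZZ E a aDn hsub H y) + H aDn y := by
  have h : (∑ z ∈ Finset.univ.filter (fun z : Ea E a =>
      ∀ i : {w // w ∈ aDn}, z ⟨i, hsub i.2⟩ = y i), Real.exp (-(H a z) + H aDn y))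
      = ZZ E a aDn hsub H y * Real.exp (H aDn y) := by
    rw [ZZ, Finset.sum_mul]
    refine Finset.sum_congr ?_ (fun z _ => Real.exp_add _ _)
    ext z
    simp [funext_iff, proj]
  rw [Hhat, h, Real.log_mul (ZZ_pos E a aDn hsub H y).ne' (Real.exp_pos _).ne', Real.log_exp]

open Classical in
lemma Marg.sum_mul {A : Finset (Finset I)} {u : Fam E A} (hu : Marg E A u) (a b : A)
    (h : (b : Finset I) ⊆ (a : Finset I)) (f : Ea E (b : Finset I) → ℝ) :
    ∑ x, u a x * f (proj E h x) = ∑ y, u b y * f y := by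
  rw [← Finset.sum_fiberwise Finset.univ (proj E h)]
  refine Finset.sum_congr rfl fun y _ => ?_
  rw [hu a b h y, Finset.sum_mul]
  refine Finset.sum_congr rfl fun x hx => ?_
  rw [(Finset.mem_filter.1 hx).2]

open Classical in
lemma mob_self {A : Finset (Finset I)} {μ} (hμ : IsMobius A μ) {x} (hx : x ∈ A) : μ x x = 1 := by
  have := hμ.2 x hx x hx subset_rfl
  rw [if_pos rfl] at this
  rw [← this]
  have : A.filter (fun b => x ⊆ b ∧ b ⊆ x) = {x} := by
    ext b
    simp only [Finset.mem_filter, Finset.mem_singleton]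
    constructor
    · rintro ⟨_, h1, h2⟩; exact h2.antisymm h1
    · rintro rfl; exact ⟨hx, subset_rfl, subset_rfl⟩
  rw [this, Finset.sum_singleton]

open Classical in
lemma mob_lt {A : Finset (Finset I)} (hc : ChainsShort A) {μ} (hμ : IsMobius A μ) {x y}
    (hx : x ∈ A) (hy : y ∈ A) (hxy : x ⊂ y) : μ y x = -1 := by
  have h1 := hμ.2 y hy x hx hxy.subset
  rw [if_neg hxy.ne'] at h1
  have : A.filter (fun b => x ⊆ b ∧ b ⊆ y) = {x, y} := by
    ext b
    simp only [Finset.mem_filter, Finset.mem_singleton, Finset.mem_insert]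
    constructor
    · rintro ⟨hb, h1, h2⟩
      by_contra! hne
      exact hc x hx b hb y hy (h1.ssubset_of_ne hne.1.symm) (h2.ssubset_of_ne hne.2)
    · rintro (rfl | rfl)
      · exact ⟨hx, subset_rfl, hxy.subset⟩
      · exact ⟨hy, hxy.subset, subset_rfl⟩
  rw [this, Finset.sum_pair hxy.ne, mob_self hμ hx] at h1
  linarith

open Classical in
lemma coefC_eq {A : Finset (Finset I)} (hc : ChainsShort A) {μ} (hμ : IsMobius A μ) {x}
    (hx : x ∈ A) : coefC A μ x = 1 - ((A.filter (fun y => x ⊂ y)).card : ℤ) := by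
  have : A.filter (fun b => x ⊆ b) = insert x (A.filter (fun y => x ⊂ y)) := by
    ext b
    simp only [Finset.mem_filter, Finset.mem_insert]
    constructor
    · rintro ⟨hb, h⟩
      by_cases e : b = x
      · exact Or.inl e
      · exact Or.inr ⟨hb, h.ssubset_of_ne (Ne.symm e)⟩
    · rintro (rfl | h)
      · exact ⟨hx, subset_rfl⟩
      · exact ⟨h.1, h.2.subset⟩
  rw [coefC, this, Finset.sum_insert (by simp), mob_self hμ hx,
    Finset.sum_congr rfl (fun y hy => mob_lt hc hμ hx (Finset.mem_filter.1 hy).1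
      (Finset.mem_filter.1 hy).2)]
  simp
  ring

/-- bilinear-type form -/
noncomputable def WW (A : Finset (Finset I)) (μ : Finset I → Finset I → ℤ)
    (H : (c : Finset I) → Ea E c → ℝ) (u Q : Fam E A) : ℝ :=
  by classical exact ∑ a : A, (coefC A μ (a : Finset I) : ℝ) *
    (∑ x, u a x * (H (a : Finset I) x + Real.log (Q a x)))

lemma BT_eq_WW (A : Finset (Finset I)) (μ : Finset I → Finset I → ℤ)
    (H : (c : Finset I) → Ea E c → ℝ) (Q : Fam E A) : BT E A μ H Q = WW E A μ H Q Q := by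
  simp only [BT, WW, entropy, mul_add, Finset.sum_add_distrib, sub_neg_eq_add]

open Classical in
lemma deriv_BT (A : Finset (Finset I)) (μ : Finset I → Finset I → ℤ)
    (H : (c : Finset I) → Ea E c → ℝ) (Q u : Fam E A) (hQ : MemLInt E A Q) (hu : MemT E A u) :
    deriv (fun t : ℝ => BT E A μ H (fun a x => Q a x + t * u a x)) 0 = WW E A μ H u Q := by
  apply HasDerivAt.deriv
  simp only [BT_eq_WW]
  unfold WW
  refine HasDerivAt.fun_sum fun c _ => HasDerivAt.const_mul _ ?_
  have key : HasDerivAt (fun t : ℝ => ∑ x, (Q c x + t * u c x) *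
      (H c x + Real.log (Q c x + t * u c x)))
      (∑ x, (u c x * (H c x + Real.log (Q c x)) + u c x)) 0 := by
    refine HasDerivAt.fun_sum fun x _ => ?_
    have hp := hQ.2 c x
    have h1 : HasDerivAt (fun t : ℝ => Q c x + t * u c x) (u c x) 0 := by
      simpa using ((hasDerivAt_id (0 : ℝ)).mul_const (u c x)).const_add (Q c x)
    have h2 := h1.mul ((h1.log (by simpa using hp.ne')).const_add (H c x))
    refine h2.congr_deriv ?_
    simp only [zero_mul, add_zero]
    field_simp
  rw [Finset.sum_add_distrib, hu.1 c, add_zero] at key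
  exact key

open Classical in
def resF (A : Finset (Finset I)) (a : Finset I) (Q : Fam E A) : Fam E (A.erase a) :=
  fun b => Q ⟨b, Finset.mem_of_mem_erase b.2⟩

open Classical in
lemma psi_a (A : Finset (Finset I)) (a aDn : Finset I) (haA : a ∈ A)
    (hsub : aDn ⊆ a) (hDn : aDn ∈ A.erase a)
    (H : (c : Finset I) → Ea E c → ℝ) (Q : Fam E (A.erase a)) (x : Ea E a) :
    psiMap E A a aDn hsub hDn H Q ⟨a, haA⟩ x =
      Q ⟨aDn, hDn⟩ (proj E hsub x) * Real.exp (-(H a x)) / ZZ E a aDn hsub H (proj E hsub x) := by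
  unfold psiMap
  rw [dif_pos rfl]
  simp only
  unfold ZZ
  congr 1
  refine Finset.sum_congr ?_ (fun z _ => rfl)
  ext z
  simp [funext_iff, proj]

open Classical in
lemma psi_ne (A : Finset (Finset I)) (a aDn : Finset I)
    (hsub : aDn ⊆ a) (hDn : aDn ∈ A.erase a)
    (H : (c : Finset I) → Ea E c → ℝ) (Q : Fam E (A.erase a)) (c : A) (h : (c : Finset I) ≠ a) :
    psiMap E A a aDn hsub hDn H Q c = Q ⟨c, Finset.mem_erase.2 ⟨h, c.2⟩⟩ := by
  funext x
  unfold psiMap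
  rw [dif_neg h]

open Classical in
lemma res_psi (A : Finset (Finset I)) (a aDn : Finset I)
    (hsub : aDn ⊆ a) (hDn : aDn ∈ A.erase a)
    (H : (c : Finset I) → Ea E c → ℝ) (Q : Fam E (A.erase a)) :
    resF E A a (psiMap E A a aDn hsub hDn H Q) = Q := by
  funext b
  exact psi_ne E A a aDn hsub hDn H Q ⟨b, _⟩ (Finset.mem_erase.1 b.2).1

open Classical in
lemma res_marg (A : Finset (Finset I)) (a : Finset I) (u : Fam E A) (hu : Marg E A u) :
    Marg E (A.erase a) (resF E A a u) :=
  fun c b h x => hu ⟨c, Finset.mem_of_mem_erase c.2⟩ ⟨b, Finset.mem_of_mem_erase b.2⟩ h x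

open Classical in
lemma psi_marg [∀ i, Nonempty (E i)] (A : Finset (Finset I)) (hchain : ChainsShort A)
    (a aDn : Finset I) (haA : a ∈ A) (hlt : aDn ⊂ a)
    (hcolin : ∀ b ∈ A, b ⊂ a → b ⊆ aDn) (hDn : aDn ∈ A.erase a)
    (H : (c : Finset I) → Ea E c → ℝ) (Q : Fam E (A.erase a)) (hQ : Marg E (A.erase a) Q) :
    Marg E A (psiMap E A a aDn hlt.subset hDn H Q) := by
  have hDnA := Finset.mem_of_mem_erase hDn
  rintro ⟨c, hc⟩ ⟨b, hb⟩ h x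
  simp only at h x
  by_cases hca : c = a
  · subst hca
    by_cases hba : b = c
    · subst hba
      have : (Finset.univ.filter (fun y : Ea E b => proj E h y = x)) = {x} := by
        ext y; simp only [Finset.mem_filter, Finset.mem_univ, true_and, Finset.mem_singleton]; exact Iff.rfl
      simp only [this, Finset.sum_singleton]
    · have hbc := h.ssubset_of_ne hba
      have : b = aDn := by
        by_contra hne
        exact hchain b hb aDn hDnA c hc ((hcolin b hb hbc).ssubset_of_ne hne) hlt
      subst this
      rw [psi_ne E A c b _ hDn H Q ⟨b, hb⟩ hba]
      have h2 : ∀ y ∈ Finset.univ.filter (fun y : Ea E c => proj E h y = x),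
          psiMap E A c b hlt.subset hDn H Q ⟨c, hc⟩ y =
            Q ⟨b, hDn⟩ x / ZZ E c b hlt.subset H x * Real.exp (-(H c y)) := by
        intro y hy
        rw [psi_a E A c b hc]
        rw [(Finset.mem_filter.1 hy).2]
        ring
      rw [Finset.sum_congr rfl h2, ← Finset.mul_sum]
      have := (ZZ_pos E c b hlt.subset H x).ne'
      change _ = _ * ZZ E c b hlt.subset H x
      field_simp
  · by_cases hba : b = a
    · subst hba
      exact (hchain aDn hDnA b hb c hc hlt (h.ssubset_of_ne (Ne.symm hca))).elim
    · rw [psi_ne E A a aDn _ hDn H Q ⟨b, hb⟩ hba, psi_ne E A a aDn _ hDn H Q ⟨c, hc⟩ hca]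
      exact hQ ⟨c, _⟩ ⟨b, _⟩ h x

open Classical in
lemma psi_sum [∀ i, Nonempty (E i)] (A : Finset (Finset I)) (hchain : ChainsShort A)
    (a aDn : Finset I) (haA : a ∈ A) (hlt : aDn ⊂ a)
    (hcolin : ∀ b ∈ A, b ⊂ a → b ⊆ aDn) (hDn : aDn ∈ A.erase a)
    (H : (c : Finset I) → Ea E c → ℝ) (Q : Fam E (A.erase a)) (hQ : Marg E (A.erase a) Q)
    (r : ℝ) (hr : ∀ b : (A.erase a : Finset _), ∑ x, Q b x = r) (c : A) :
    ∑ x, psiMap E A a aDn hlt.subset hDn H Q c x = r := by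
  have hDnA := Finset.mem_of_mem_erase hDn
  obtain ⟨c, hc⟩ := c
  by_cases hca : c = a
  · subst hca
    have := (psi_marg E A hchain c aDn haA hlt hcolin hDn H Q hQ).sum_mul E ⟨c, hc⟩ ⟨aDn, hDnA⟩
      hlt.subset (fun _ => 1)
    simp only [mul_one] at this
    rw [this, psi_ne E A c aDn _ hDn H Q ⟨aDn, hDnA⟩ hlt.ne]
    exact hr ⟨aDn, hDn⟩
  · rw [psi_ne E A a aDn _ hDn H Q ⟨c, hc⟩ hca]
    exact hr ⟨c, Finset.mem_erase.2 ⟨hca, hc⟩⟩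

open Classical in
lemma psi_memT [∀ i, Nonempty (E i)] (A : Finset (Finset I)) (hchain : ChainsShort A)
    (a aDn : Finset I) (haA : a ∈ A) (hlt : aDn ⊂ a)
    (hcolin : ∀ b ∈ A, b ⊂ a → b ⊆ aDn) (hDn : aDn ∈ A.erase a)
    (H : (c : Finset I) → Ea E c → ℝ) (Q : Fam E (A.erase a)) (hQ : MemT E (A.erase a) Q) :
    MemT E A (psiMap E A a aDn hlt.subset hDn H Q) :=
  ⟨psi_sum E A hchain a aDn haA hlt hcolin hDn H Q hQ.2 0 hQ.1,
    psi_marg E A hchain a aDn haA hlt hcolin hDn H Q hQ.2⟩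

open Classical in
lemma psi_memL [∀ i, Nonempty (E i)] (A : Finset (Finset I)) (hchain : ChainsShort A)
    (a aDn : Finset I) (haA : a ∈ A) (hlt : aDn ⊂ a)
    (hcolin : ∀ b ∈ A, b ⊂ a → b ⊆ aDn) (hDn : aDn ∈ A.erase a)
    (H : (c : Finset I) → Ea E c → ℝ) (Q : Fam E (A.erase a)) (hQ : MemL E (A.erase a) Q) :
    MemL E A (psiMap E A a aDn hlt.subset hDn H Q) := by
  refine ⟨fun c => ⟨fun x => ?_, psi_sum E A hchain a aDn haA hlt hcolin hDn H Q hQ.2 1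
    (fun b => (hQ.1 b).2) c⟩, psi_marg E A hchain a aDn haA hlt hcolin hDn H Q hQ.2⟩
  obtain ⟨c, hc⟩ := c
  by_cases hca : c = a
  · subst hca
    rw [psi_a E A c aDn hc]
    exact div_nonneg (mul_nonneg ((hQ.1 _).1 _) (Real.exp_pos _).le) (ZZ_pos E _ _ _ H _).le
  · rw [psi_ne E A a aDn _ hDn H Q ⟨c, hc⟩ hca]
    exact (hQ.1 _).1 _

open Classical in
lemma psi_memLInt [∀ i, Nonempty (E i)] (A : Finset (Finset I)) (hchain : ChainsShort A)
    (a aDn : Finset I) (haA : a ∈ A) (hlt : aDn ⊂ a)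
    (hcolin : ∀ b ∈ A, b ⊂ a → b ⊆ aDn) (hDn : aDn ∈ A.erase a)
    (H : (c : Finset I) → Ea E c → ℝ) (Q : Fam E (A.erase a)) (hQ : MemLInt E (A.erase a) Q) :
    MemLInt E A (psiMap E A a aDn hlt.subset hDn H Q) := by
  refine ⟨psi_memL E A hchain a aDn haA hlt hcolin hDn H Q hQ.1, fun c x => ?_⟩
  obtain ⟨c, hc⟩ := c
  by_cases hca : c = a
  · subst hca
    rw [psi_a E A c aDn hc]
    exact div_pos (mul_pos (hQ.2 _ _) (Real.exp_pos _)) (ZZ_pos E _ _ _ H _)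
  · rw [psi_ne E A a aDn _ hDn H Q ⟨c, hc⟩ hca]
    exact hQ.2 _ _

open Classical in
lemma res_memL (A : Finset (Finset I)) (a : Finset I) (Q : Fam E A) (hQ : MemL E A Q) :
    MemL E (A.erase a) (resF E A a Q) :=
  ⟨fun c => hQ.1 ⟨c, Finset.mem_of_mem_erase c.2⟩, res_marg E A a Q hQ.2⟩

open Classical in
lemma res_memLInt (A : Finset (Finset I)) (a : Finset I) (Q : Fam E A) (hQ : MemLInt E A Q) :
    MemLInt E (A.erase a) (resF E A a Q) :=
  ⟨res_memL E A a Q hQ.1, fun c => hQ.2 ⟨c, Finset.mem_of_mem_erase c.2⟩⟩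

open Classical in
lemma res_memT (A : Finset (Finset I)) (a : Finset I) (Q : Fam E A) (hQ : MemT E A Q) :
    MemT E (A.erase a) (resF E A a Q) :=
  ⟨fun c => hQ.1 ⟨c, Finset.mem_of_mem_erase c.2⟩, res_marg E A a Q hQ.2⟩

open Classical in
/-- combinatorial decomposition -/
lemma sum_decomp (A : Finset (Finset I)) (hchain : ChainsShort A)
    (a aDn : Finset I) (haA : a ∈ A) (hlt : aDn ⊂ a)
    (hcolin : ∀ b ∈ A, b ⊂ a → b ⊆ aDn) (hDn : aDn ∈ A.erase a)
    (μA : Finset I → Finset I → ℤ) (hμA : IsMobius A μA)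
    (μB : Finset I → Finset I → ℤ) (hμB : IsMobius (A.erase a) μB) (g : A → ℝ) :
    ∑ c : A, (coefC A μA (c : Finset I) : ℝ) * g c =
      ∑ b : (A.erase a : Finset _), (coefC (A.erase a) μB (b : Finset I) : ℝ) *
        g ⟨b, Finset.mem_of_mem_erase b.2⟩ +
      (g ⟨a, haA⟩ - g ⟨aDn, Finset.mem_of_mem_erase hDn⟩) := by
  have hDnA := Finset.mem_of_mem_erase hDn
  have hchB : ChainsShort (A.erase a) := fun x hx y hy z hz =>
    hchain x (Finset.mem_of_mem_erase hx) y (Finset.mem_of_mem_erase hy) z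
      (Finset.mem_of_mem_erase hz)
  have hca : coefC A μA a = 1 := by
    rw [coefC_eq hchain hμA haA]
    have : A.filter (fun y => a ⊂ y) = ∅ := by
      rw [Finset.filter_eq_empty_iff]
      intro y hy hay
      exact hchain aDn hDnA a haA y hy hlt hay
    simp [this]
  have hcb : ∀ b ∈ A.erase a, coefC A μA b = coefC (A.erase a) μB b - if b = aDn then 1 else 0 := by
    intro b hb
    have hbA := Finset.mem_of_mem_erase hb
    rw [coefC_eq hchain hμA hbA, coefC_eq hchB hμB hb]
    have hf : (A.erase a).filter (fun y => b ⊂ y) = (A.filter (fun y => b ⊂ y)).erase a := by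
      ext y; simp only [Finset.mem_filter, Finset.mem_erase]; tauto
    split_ifs with e
    · subst e
      have hm : a ∈ A.filter (fun y => b ⊂ y) := Finset.mem_filter.2 ⟨haA, hlt⟩
      rw [hf, ← Finset.card_erase_add_one hm]
      push_cast; ring
    · have hm : a ∉ A.filter (fun y => b ⊂ y) := by
        intro hm
        have hba := (Finset.mem_filter.1 hm).2
        exact hchain b hbA aDn hDnA a haA ((hcolin b hbA hba).ssubset_of_ne e) hlt
      rw [hf, Finset.erase_eq_of_notMem hm]
      simp
  let G : Finset I → ℝ := fun c => if h : c ∈ A then g ⟨c, h⟩ else 0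
  have hG : ∀ c (h : c ∈ A), g ⟨c, h⟩ = G c := fun c h => by simp [G, h]
  have e1 : ∑ c : A, (coefC A μA (c : Finset I) : ℝ) * g c =
      ∑ c ∈ A, (coefC A μA c : ℝ) * G c := by
    rw [← Finset.sum_coe_sort A]
    exact Finset.sum_congr rfl fun c _ => by rw [← hG c c.2]
  have e2 : ∑ b : (A.erase a : Finset _), (coefC (A.erase a) μB (b : Finset I) : ℝ) *
        g ⟨b, Finset.mem_of_mem_erase b.2⟩ =
      ∑ c ∈ A.erase a, (coefC (A.erase a) μB c : ℝ) * G c := by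
    rw [← Finset.sum_coe_sort (A.erase a)]
    exact Finset.sum_congr rfl fun c _ => by rw [hG]
  rw [e1, e2, hG, hG, ← Finset.add_sum_erase A _ haA, hca]
  have e3 : ∑ c ∈ A.erase a, (coefC A μA c : ℝ) * G c =
      ∑ c ∈ A.erase a, ((coefC (A.erase a) μB c : ℝ) * G c - if c = aDn then G c else 0) := by
    refine Finset.sum_congr rfl fun c hc => ?_
    rw [hcb c hc]
    push_cast
    split_ifs <;> ring
  rw [e3, Finset.sum_sub_distrib, Finset.sum_ite_eq' (A.erase a) aDn, if_pos hDn]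
  push_cast; ring

open Classical in
lemma coef_ne (A : Finset (Finset I)) (hchain : ChainsShort A) (aDn : Finset I) (hDn : aDn ∈ A)
    (μ : Finset I → Finset I → ℤ) (hμ : IsMobius A μ)
    (hn : ¬ ∃ bUp ∈ A, aDn ⊂ bUp ∧ ∀ c ∈ A, aDn ⊂ c → bUp ⊆ c) : coefC A μ aDn ≠ 0 := by
  rw [coefC_eq hchain hμ hDn]
  intro h
  have : (A.filter (fun y => aDn ⊂ y)).card = 1 := by omega
  obtain ⟨b, hb⟩ := Finset.card_eq_one.1 this
  have hb' : b ∈ A.filter (fun y => aDn ⊂ y) := by simp [hb]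
  refine hn ⟨b, (Finset.mem_filter.1 hb').1, (Finset.mem_filter.1 hb').2, fun c hc hac => ?_⟩
  have : c ∈ A.filter (fun y => aDn ⊂ y) := Finset.mem_filter.2 ⟨hc, hac⟩
  rw [hb, Finset.mem_singleton] at this
  rw [this]

open Classical in
lemma tilde_sum (B : Finset (Finset I)) (hchain : ChainsShort B) (aDn : Finset I) (hDn : aDn ∈ B)
    (μ : Finset I → Finset I → ℤ) (hμ : IsMobius B μ) (K : Ea E aDn → ℝ)
    (H Ht : (c : Finset I) → Ea E c → ℝ)
    (hcase1 : ∀ bUp ∈ B, (hlt2 : aDn ⊂ bUp) →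
      (∀ c ∈ B, aDn ⊂ c → bUp ⊆ c) →
      (∀ c ∈ B, c ≠ bUp → Ht c = H c) ∧
      (∀ x : Ea E bUp, Ht bUp x = H bUp x - K (fun i => x ⟨i, hlt2.subset i.2⟩)))
    (hcase2 : (¬ ∃ bUp ∈ B, aDn ⊂ bUp ∧ ∀ c ∈ B, aDn ⊂ c → bUp ⊆ c) →
      (∀ c ∈ B, c ≠ aDn → Ht c = H c) ∧
      (∀ x : Ea E aDn, Ht aDn x = H aDn x - K x / (coefC B μ aDn : ℝ)))
    (u Q : Fam E B) (hu : Marg E B u) :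
    WW E B μ Ht u Q = WW E B μ H u Q - ∑ y, u ⟨aDn, hDn⟩ y * K y := by
  suffices h : ∑ b : B, (coefC B μ (b : Finset I) : ℝ) *
      (∑ x, u b x * (H b x - Ht b x)) = ∑ y, u ⟨aDn, hDn⟩ y * K y by
    rw [← h, WW, WW, ← Finset.sum_sub_distrib]
    refine Finset.sum_congr rfl fun b _ => ?_
    rw [← mul_sub, ← Finset.sum_sub_distrib]
    congr 1
    exact Finset.sum_congr rfl fun x _ => by ring
  by_cases hl : ∃ bUp ∈ B, aDn ⊂ bUp ∧ ∀ c ∈ B, aDn ⊂ c → bUp ⊆ c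
  · obtain ⟨b, hb, hlt2, hmin⟩ := hl
    obtain ⟨h1, h2⟩ := hcase1 b hb hlt2 hmin
    have hcb : coefC B μ b = 1 := by
      rw [coefC_eq hchain hμ hb]
      have : B.filter (fun y => b ⊂ y) = ∅ := by
        rw [Finset.filter_eq_empty_iff]
        intro y hy hay
        exact hchain aDn hDn b hb y hy hlt2 hay
      simp [this]
    rw [Finset.sum_eq_single (⟨b, hb⟩ : B)]
    · simp only [hcb, Int.cast_one, one_mul]
      rw [← hu.sum_mul E ⟨b, hb⟩ ⟨aDn, hDn⟩ hlt2.subset K]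
      refine Finset.sum_congr rfl fun x _ => ?_
      rw [h2 x, sub_sub_cancel]
      rfl
    · rintro ⟨c, hc⟩ _ hne
      have : c ≠ b := fun e => hne (Subtype.ext e)
      simp [h1 c hc this]
    · simp
  · obtain ⟨h1, h2⟩ := hcase2 hl
    have hne := coef_ne B hchain aDn hDn μ hμ hl
    have hne' : (coefC B μ aDn : ℝ) ≠ 0 := by exact_mod_cast hne
    rw [Finset.sum_eq_single (⟨aDn, hDn⟩ : B)]
    · rw [Finset.mul_sum]
      refine Finset.sum_congr rfl fun x _ => ?_
      simp only [h2 x]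
      field_simp
      ring
    · rintro ⟨c, hc⟩ _ hne
      have : c ≠ aDn := fun e => hne (Subtype.ext e)
      simp [h1 c hc this]
    · simp

lemma gibbs {p q : ℝ} (hp : 0 < p) (hq : 0 ≤ q) :
    q - p ≤ q * (Real.log q - Real.log p) ∧ (q * (Real.log q - Real.log p) = q - p → q = p) := by
  rcases hq.eq_or_lt with rfl | hq
  · simp; refine ⟨hp.le, fun h => h.symm⟩
  have h1 := Real.log_le_sub_one_of_pos (div_pos hp hq)
  have hl : Real.log (p / q) = Real.log p - Real.log q := Real.log_div hp.ne' hq.ne'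
  have e : q * (p / q - 1) = p - q := by field_simp
  constructor
  · have := mul_le_mul_of_nonneg_left h1 hq.le
    rw [e, hl] at this
    linarith
  · intro h
    by_contra hne
    have h1 := Real.log_lt_sub_one_of_pos (div_pos hp hq)
      (fun h => hne ((div_eq_one_iff_eq hq.ne').1 h).symm)
    have := mul_lt_mul_of_pos_left h1 hq
    rw [e, hl] at this
    linarith

lemma mono_eq {p q : ℝ} (hp : 0 < p) (hq : 0 < q) :
    0 ≤ (q - p) * (Real.log q - Real.log p) ∧
      ((q - p) * (Real.log q - Real.log p) = 0 → q = p) := by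
  constructor
  · rcases le_total p q with h | h
    · exact mul_nonneg (by linarith) (by linarith [Real.log_le_log hp h])
    · exact mul_nonneg_of_nonpos_of_nonpos (by linarith) (by linarith [Real.log_le_log hq h])
  · intro h
    rcases mul_eq_zero.1 h with h | h
    · linarith
    · exact Real.log_injOn_pos hq hp (by linarith)

open Classical in
/-- key decomposition -/
lemma WW_decomp [∀ i, Nonempty (E i)] (A : Finset (Finset I)) (hchain : ChainsShort A)
    (a aDn : Finset I) (haA : a ∈ A) (hlt : aDn ⊂ a)
    (hcolin : ∀ b ∈ A, b ⊂ a → b ⊆ aDn) (hDn : aDn ∈ A.erase a)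
    (μA : Finset I → Finset I → ℤ) (hμA : IsMobius A μA)
    (μB : Finset I → Finset I → ℤ) (hμB : IsMobius (A.erase a) μB)
    (H Ht : (c : Finset I) → Ea E c → ℝ)
    (htil : ∀ u Q : Fam E (A.erase a), Marg E (A.erase a) u →
      WW E (A.erase a) μB Ht u Q = WW E (A.erase a) μB H u Q -
        ∑ y, u ⟨aDn, hDn⟩ y * Hhat E a aDn hlt.subset H y)
    (u Q : Fam E A) (hu : Marg E A u) :
    WW E A μA H u Q = WW E (A.erase a) μB Ht (resF E A a u) (resF E A a Q) +
      ∑ x, u ⟨a, haA⟩ x * (H a x + Real.log (Q ⟨a, haA⟩ x)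
        - Real.log (Q ⟨aDn, Finset.mem_of_mem_erase hDn⟩ (proj E hlt.subset x))
        + Real.log (ZZ E a aDn hlt.subset H (proj E hlt.subset x))) := by
  have hDnA := Finset.mem_of_mem_erase hDn
  rw [htil _ _ (res_marg E A a u hu)]
  have h1 := sum_decomp A hchain a aDn haA hlt hcolin hDn μA hμA μB hμB
    (fun c => ∑ x, u c x * (H (c : Finset I) x + Real.log (Q c x)))
  have h2 : WW E (A.erase a) μB H (resF E A a u) (resF E A a Q) =
    ∑ b : (A.erase a : Finset _), (coefC (A.erase a) μB (b : Finset I) : ℝ) *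
        ∑ x, u ⟨b, Finset.mem_of_mem_erase b.2⟩ x * (H (b : Finset I) x +
          Real.log (Q ⟨b, Finset.mem_of_mem_erase b.2⟩ x)) := rfl
  have h3 : WW E A μA H u Q = ∑ c : A, (coefC A μA (c : Finset I) : ℝ) *
    ∑ x, u c x * (H (c : Finset I) x + Real.log (Q c x)) := rfl
  rw [h3, h1, h2]
  have h4 := hu.sum_mul E ⟨a, haA⟩ ⟨aDn, hDnA⟩ hlt.subset
    (fun y => Real.log (ZZ E a aDn hlt.subset H y) - Real.log (Q ⟨aDn, hDnA⟩ y))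
  have h5 : ∑ y, resF E A a u ⟨aDn, hDn⟩ y * Hhat E a aDn hlt.subset H y =
      ∑ y, u ⟨aDn, hDnA⟩ y * (Real.log (ZZ E a aDn hlt.subset H y) + H aDn y) :=
    Finset.sum_congr rfl fun y _ => by rw [Hhat_eq]; rfl
  rw [h5]
  have h6 : ∑ x, u ⟨a, haA⟩ x * (H a x + Real.log (Q ⟨a, haA⟩ x)
        - Real.log (Q ⟨aDn, hDnA⟩ (proj E hlt.subset x))
        + Real.log (ZZ E a aDn hlt.subset H (proj E hlt.subset x))) =
      ∑ x, u ⟨a, haA⟩ x * (H a x + Real.log (Q ⟨a, haA⟩ x)) +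
      ∑ y, u ⟨aDn, hDnA⟩ y * (Real.log (ZZ E a aDn hlt.subset H y) - Real.log (Q ⟨aDn, hDnA⟩ y)) := by
    rw [← h4, ← Finset.sum_add_distrib]
    exact Finset.sum_congr rfl fun x _ => by ring
  rw [h6]
  simp only [mul_add, mul_sub, Finset.sum_add_distrib, Finset.sum_sub_distrib]
  ring

open Classical in
lemma log_psi [∀ i, Nonempty (E i)] (A : Finset (Finset I)) (a aDn : Finset I) (haA : a ∈ A)
    (hsub : aDn ⊆ a) (hDn : aDn ∈ A.erase a)
    (H : (c : Finset I) → Ea E c → ℝ) (Q : Fam E (A.erase a)) (x : Ea E a)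
    (hx : 0 < Q ⟨aDn, hDn⟩ (proj E hsub x)) :
    0 < psiMap E A a aDn hsub hDn H Q ⟨a, haA⟩ x ∧
    Real.log (psiMap E A a aDn hsub hDn H Q ⟨a, haA⟩ x) =
      Real.log (Q ⟨aDn, hDn⟩ (proj E hsub x)) - H a x -
        Real.log (ZZ E a aDn hsub H (proj E hsub x)) := by
  have hZ := ZZ_pos E a aDn hsub H (proj E hsub x)
  rw [psi_a E A a aDn haA]
  refine ⟨div_pos (mul_pos hx (Real.exp_pos _)) hZ, ?_⟩
  rw [Real.log_div (mul_pos hx (Real.exp_pos _)).ne' hZ.ne',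
    Real.log_mul hx.ne' (Real.exp_pos _).ne', Real.log_exp]
  ring

open Classical in
lemma eq_psi (A : Finset (Finset I)) (a aDn : Finset I) (haA : a ∈ A)
    (hsub : aDn ⊆ a) (hDn : aDn ∈ A.erase a)
    (H : (c : Finset I) → Ea E c → ℝ) (Q : Fam E A)
    (h : ∀ x, Q ⟨a, haA⟩ x = psiMap E A a aDn hsub hDn H (resF E A a Q) ⟨a, haA⟩ x) :
    psiMap E A a aDn hsub hDn H (resF E A a Q) = Q := by
  funext ⟨c, hc⟩
  by_cases hca : c = a
  · subst hca
    funext x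
    exact (h x).symm
  · rw [psi_ne E A a aDn hsub hDn H _ ⟨c, hc⟩ hca]
    rfl

open Classical in
theorem main_aux [∀ i, Nonempty (E i)] (A : Finset (Finset I)) (hchain : ChainsShort A)
    (a aDn : Finset I) (haA : a ∈ A) (hlt : aDn ⊂ a)
    (hcolin : ∀ b ∈ A, b ⊂ a → b ⊆ aDn) (hDn : aDn ∈ A.erase a)
    (μA : Finset I → Finset I → ℤ) (hμA : IsMobius A μA)
    (μB : Finset I → Finset I → ℤ) (hμB : IsMobius (A.erase a) μB)
    (H Ht : (c : Finset I) → Ea E c → ℝ)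
    (htil : ∀ u Q : Fam E (A.erase a), Marg E (A.erase a) u →
      WW E (A.erase a) μB Ht u Q = WW E (A.erase a) μB H u Q -
        ∑ y, u ⟨aDn, hDn⟩ y * Hhat E a aDn hlt.subset H y) :
    Set.BijOn (psiMap E A a aDn hlt.subset hDn H)
      {Q : Fam E (A.erase a) | IsMinimizer E (A.erase a) (BT E (A.erase a) μB Ht) Q}
      {Q : Fam E A | IsMinimizer E A (BT E A μA H) Q} ∧
    Set.BijOn (psiMap E A a aDn hlt.subset hDn H)
      {Q : Fam E (A.erase a) | IsCritical E (A.erase a) (BT E (A.erase a) μB Ht) Q}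
      {Q : Fam E A | IsCritical E A (BT E A μA H) Q} := by
  have hDnA := Finset.mem_of_mem_erase hDn
  have hdec := WW_decomp E A hchain a aDn haA hlt hcolin hDn μA hμA μB hμB H Ht htil
  set ψ := psiMap E A a aDn hlt.subset hDn H with hψ
  have hres : ∀ P, resF E A a (ψ P) = P := res_psi E A a aDn hlt.subset hDn H
  have hψL : ∀ P, MemL E (A.erase a) P → MemL E A (ψ P) :=
    psi_memL E A hchain a aDn haA hlt hcolin hDn H
  have hψI : ∀ P, MemLInt E (A.erase a) P → MemLInt E A (ψ P) :=
    psi_memLInt E A hchain a aDn haA hlt hcolin hDn H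
  have hψT : ∀ P, MemT E (A.erase a) P → MemT E A (ψ P) :=
    psi_memT E A hchain a aDn haA hlt hcolin hDn H
  have hinj : Function.Injective ψ := fun P P' h => by rw [← hres P, h, hres]
  have hψdn : ∀ P, ψ P ⟨aDn, hDnA⟩ = P ⟨aDn, hDn⟩ := fun P =>
    psi_ne E A a aDn hlt.subset hDn H P ⟨aDn, hDnA⟩ hlt.ne
  -- value on the image
  have hval : ∀ P, MemL E (A.erase a) P → BT E A μA H (ψ P) = BT E (A.erase a) μB Ht P := by
    intro P hP
    rw [BT_eq_WW, BT_eq_WW, hdec _ _ (hψL P hP).2, hres, add_eq_left]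
    refine Finset.sum_eq_zero fun x _ => ?_
    rcases ((hP.1 ⟨aDn, hDn⟩).1 (proj E hlt.subset x)).eq_or_lt with h0 | hpos
    · have : ψ P ⟨a, haA⟩ x = 0 := by
        rw [hψ, psi_a E A a aDn haA, ← h0]; simp
      rw [this, zero_mul]
    · rw [(log_psi E A a aDn haA hlt.subset hDn H P x hpos).2, hψdn]
      ring
  -- lower bound
  have hlow : ∀ Q, MemL E A Q → BT E (A.erase a) μB Ht (resF E A a Q) ≤ BT E A μA H Q ∧
      (BT E A μA H Q = BT E (A.erase a) μB Ht (resF E A a Q) → ψ (resF E A a Q) = Q) := by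
    intro Q hQ
    rw [BT_eq_WW, BT_eq_WW, hdec _ _ hQ.2]
    have hrL := res_memL E A a Q hQ
    have hterm : ∀ x, Q ⟨a, haA⟩ x - ψ (resF E A a Q) ⟨a, haA⟩ x ≤
        Q ⟨a, haA⟩ x * (H a x + Real.log (Q ⟨a, haA⟩ x)
          - Real.log (Q ⟨aDn, hDnA⟩ (proj E hlt.subset x))
          + Real.log (ZZ E a aDn hlt.subset H (proj E hlt.subset x))) ∧
        (Q ⟨a, haA⟩ x * (H a x + Real.log (Q ⟨a, haA⟩ x)
          - Real.log (Q ⟨aDn, hDnA⟩ (proj E hlt.subset x))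
          + Real.log (ZZ E a aDn hlt.subset H (proj E hlt.subset x))) =
          Q ⟨a, haA⟩ x - ψ (resF E A a Q) ⟨a, haA⟩ x →
          Q ⟨a, haA⟩ x = ψ (resF E A a Q) ⟨a, haA⟩ x) := by
      intro x
      rcases ((hQ.1 ⟨aDn, hDnA⟩).1 (proj E hlt.subset x)).eq_or_lt with h0 | hpos
      · have h1 : ψ (resF E A a Q) ⟨a, haA⟩ x = 0 := by
          rw [hψ, psi_a E A a aDn haA]
          have : resF E A a Q ⟨aDn, hDn⟩ (proj E hlt.subset x) = 0 := h0.symm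
          rw [this]; simp
        have h2 : Q ⟨a, haA⟩ x = 0 := by
          have := hQ.2 ⟨a, haA⟩ ⟨aDn, hDnA⟩ hlt.subset (proj E hlt.subset x)
          rw [← h0] at this
          exact (Finset.sum_eq_zero_iff_of_nonneg (fun y _ => (hQ.1 ⟨a, haA⟩).1 y)).1 this.symm x
            (by simp)
        simp [h1, h2]
      · obtain ⟨h1, h2⟩ := log_psi E A a aDn haA hlt.subset hDn H (resF E A a Q) x hpos
        have h3 := gibbs h1 ((hQ.1 ⟨a, haA⟩).1 x)
        rw [h2] at h3
        have h4 : resF E A a Q ⟨aDn, hDn⟩ (proj E hlt.subset x) =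
          Q ⟨aDn, hDnA⟩ (proj E hlt.subset x) := rfl
        rw [h4] at h3
        convert h3 using 3 <;> ring
    have hsum : ∑ x, (Q ⟨a, haA⟩ x - ψ (resF E A a Q) ⟨a, haA⟩ x) = 0 := by
      rw [Finset.sum_sub_distrib, (hQ.1 ⟨a, haA⟩).2, ((hψL _ hrL).1 ⟨a, haA⟩).2, sub_self]
    constructor
    · have := Finset.sum_le_sum (s := Finset.univ) (fun x _ => (hterm x).1)
      rw [hsum] at this
      linarith
    · intro h
      rw [add_eq_left, ← hsum, eq_comm, Finset.sum_eq_sum_iff_of_le (fun x _ => (hterm x).1)] at h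
      exact eq_psi E A a aDn haA hlt.subset hDn H Q
        (fun x => (hterm x).2 (h x (Finset.mem_univ _)).symm)
  -- derivative at the image
  have hder : ∀ P u, MemLInt E (A.erase a) P → Marg E A u →
      WW E A μA H u (ψ P) = WW E (A.erase a) μB Ht (resF E A a u) P := by
    intro P u hP hu
    rw [hdec _ _ hu, hres, add_eq_left]
    refine Finset.sum_eq_zero fun x _ => ?_
    rw [(log_psi E A a aDn haA hlt.subset hDn H P x (hP.2 _ _)).2, hψdn]
    ring
  refine ⟨⟨?_, hinj.injOn, ?_⟩, ⟨?_, hinj.injOn, ?_⟩⟩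
  · intro P hP
    refine ⟨hψL P hP.1, fun Q hQ => ?_⟩
    rw [hval P hP.1]
    exact (hP.2 _ (res_memL E A a Q hQ)).trans (hlow Q hQ).1
  · intro Q hQ
    have hrL := res_memL E A a Q hQ.1
    refine ⟨resF E A a Q, ⟨hrL, fun P hP => ?_⟩, ?_⟩
    · rw [← hval P hP]
      exact (hlow Q hQ.1).1.trans (hQ.2 _ (hψL P hP))
    · refine (hlow Q hQ.1).2 (le_antisymm ?_ (hlow Q hQ.1).1)
      rw [← hval _ hrL]
      exact hQ.2 _ (hψL _ hrL)
  · intro P hP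
    refine ⟨hψI P hP.1, fun u hu => ?_⟩
    rw [deriv_BT E A μA H _ u (hψI P hP.1) hu, hder P u hP.1 hu.2,
      ← deriv_BT E (A.erase a) μB Ht P _ hP.1 (res_memT E A a u hu)]
    exact hP.2 _ (res_memT E A a u hu)
  · intro Q hQ
    have hrI := res_memLInt E A a Q hQ.1
    have hpsiI := hψI _ hrI
    have hfix : ψ (resF E A a Q) = Q := by
      let u : Fam E A := fun c x => Q c x - ψ (resF E A a Q) c x
      have hu : MemT E A u := by
        refine ⟨fun c => ?_, fun c b h x => ?_⟩
        · rw [Finset.sum_sub_distrib, (hQ.1.1.1 c).2, (hpsiI.1.1 c).2, sub_self]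
        · rw [Finset.sum_sub_distrib, ← hQ.1.1.2 c b h x, ← hpsiI.1.2 c b h x]
      have h1 := hQ.2 u hu
      rw [deriv_BT E A μA H Q u hQ.1 hu, hdec _ _ hu.2] at h1
      have h2 : resF E A a u = fun _ _ => 0 := by
        have : resF E A a u = fun b x => resF E A a Q b x -
          resF E A a (ψ (resF E A a Q)) b x := rfl
        rw [this, hres]
        simp
      have h3 : WW E (A.erase a) μB Ht (resF E A a u) (resF E A a Q) = 0 := by
        rw [h2]; simp [WW]
      rw [h3, zero_add] at h1
      have h4 : ∀ x, u ⟨a, haA⟩ x * (H a x + Real.log (Q ⟨a, haA⟩ x)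
          - Real.log (Q ⟨aDn, hDnA⟩ (proj E hlt.subset x))
          + Real.log (ZZ E a aDn hlt.subset H (proj E hlt.subset x))) =
          (Q ⟨a, haA⟩ x - ψ (resF E A a Q) ⟨a, haA⟩ x) *
          (Real.log (Q ⟨a, haA⟩ x) - Real.log (ψ (resF E A a Q) ⟨a, haA⟩ x)) := by
        intro x
        rw [(log_psi E A a aDn haA hlt.subset hDn H (resF E A a Q) x (hrI.2 _ _)).2]
        have h4 : resF E A a Q ⟨aDn, hDn⟩ (proj E hlt.subset x) =
          Q ⟨aDn, hDnA⟩ (proj E hlt.subset x) := rfl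
        rw [h4]
        simp only [u]
        ring
      rw [Finset.sum_congr rfl (fun x _ => h4 x), Finset.sum_eq_zero_iff_of_nonneg
        (fun x _ => (mono_eq (hpsiI.2 _ x) (hQ.1.2 _ x)).1)] at h1
      exact eq_psi E A a aDn haA hlt.subset hDn H Q
        (fun x => (mono_eq (hpsiI.2 _ x) (hQ.1.2 _ x)).2 (h1 x (Finset.mem_univ _)))
    refine ⟨resF E A a Q, ⟨hrI, fun v hv => ?_⟩, hfix⟩
    rw [deriv_BT E (A.erase a) μB Ht _ v hrI hv]
    have h1 := hQ.2 _ (hψT v hv)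
    rw [deriv_BT E A μA H Q _ hQ.1 (hψT v hv)] at h1
    have h2 := hder (resF E A a Q) (ψ v) hrI (hψT v hv).2
    rw [hres, hfix] at h2
    rw [← h2, h1]

end Helpers

open Classical in
-- Let `A ⊆ P(I)` have chains of length at most 1, `H_c` Hamiltonians, `a ∈ A` colinear with
-- witness `aDn`, `B = A∖{a}`.  Define `H̃` on `B` by: (Case 1) if `aDn` is a linear point of
-- `B` with witness `bUp`, then `H̃_c = H_c` for `c ≠ bUp` and
-- `H̃_{bUp}(x) = H_{bUp}(x) − Ĥ_{aDn}(x_{aDn})`; (Case 2) if `aDn` is not a linear point of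
-- `B`, then `c_B(aDn) ≠ 0`, `H̃_c = H_c` for `c ≠ aDn` and
-- `H̃_{aDn}(x) = H_{aDn}(x) − Ĥ_{aDn}(x)/c_B(aDn)`.  Then `ψ` restricts to a bijection
-- between the global minimizers of `BT_{B,H̃}` over `L(B)` and those of `BT_{A,H}` over
-- `L(A)`, and between the critical points of `BT_{B,H̃}` in `L(B)°` and those of `BT_{A,H}`
-- in `L(A)°`.
theorem stmt18 {I : Type} [Fintype I] [DecidableEq I]
    (E : I → Type) [∀ i, Fintype (E i)] [∀ i, DecidableEq (E i)] [∀ i, Nonempty (E i)]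
    (A : Finset (Finset I)) (hchain : ChainsShort A)
    (a aDn : Finset I) (haA : a ∈ A) (hDnA : aDn ∈ A) (hlt : aDn ⊂ a)
    (hcolin : ∀ b ∈ A, b ⊂ a → b ⊆ aDn)
    (hDnB : aDn ∈ A.erase a)
    (μA : Finset I → Finset I → ℤ) (hμA : IsMobius A μA)
    (μB : Finset I → Finset I → ℤ) (hμB : IsMobius (A.erase a) μB)
    (H : (c : Finset I) → Ea E c → ℝ)
    (Ht : (c : Finset I) → Ea E c → ℝ)
    (hcase1 : ∀ bUp ∈ A.erase a, (hlt2 : aDn ⊂ bUp) →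
      (∀ c ∈ A.erase a, aDn ⊂ c → bUp ⊆ c) →
      (∀ c ∈ A.erase a, c ≠ bUp → Ht c = H c) ∧
      (∀ x : Ea E bUp,
        Ht bUp x = H bUp x - Hhat E a aDn hlt.subset H (fun i => x ⟨i, hlt2.subset i.2⟩)))
    (hcase2 : (¬ ∃ bUp ∈ A.erase a, aDn ⊂ bUp ∧ ∀ c ∈ A.erase a, aDn ⊂ c → bUp ⊆ c) →
      (∀ c ∈ A.erase a, c ≠ aDn → Ht c = H c) ∧
      (∀ x : Ea E aDn,
        Ht aDn x = H aDn x - Hhat E a aDn hlt.subset H x / (coefC (A.erase a) μB aDn : ℝ))) :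
    ((¬ ∃ bUp ∈ A.erase a, aDn ⊂ bUp ∧ ∀ c ∈ A.erase a, aDn ⊂ c → bUp ⊆ c) →
      coefC (A.erase a) μB aDn ≠ 0) ∧
    Set.BijOn (psiMap E A a aDn hlt.subset hDnB H)
      {Q : Fam E (A.erase a) | IsMinimizer E (A.erase a) (BT E (A.erase a) μB Ht) Q}
      {Q : Fam E A | IsMinimizer E A (BT E A μA H) Q} ∧
    Set.BijOn (psiMap E A a aDn hlt.subset hDnB H)
      {Q : Fam E (A.erase a) | IsCritical E (A.erase a) (BT E (A.erase a) μB Ht) Q}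
      {Q : Fam E A | IsCritical E A (BT E A μA H) Q} := by
  have hinst : ‹DecidableEq I› = (fun x y => Classical.propDecidable (x = y)) :=
    Subsingleton.elim _ _
  subst hinst
  have hchB : ChainsShort (A.erase a) := fun x hx y hy z hz =>
    hchain x (Finset.mem_of_mem_erase hx) y (Finset.mem_of_mem_erase hy) z
      (Finset.mem_of_mem_erase hz)
  refine ⟨coef_ne (A.erase a) hchB aDn hDnB μB hμB, ?_⟩
  exact main_aux E A hchain a aDn haA hlt hcolin hDnB μA hμA μB hμB H Ht
    (tilde_sum E (A.erase a) hchB aDn hDnB μB hμB (Hhat E a aDn hlt.subset H) H Ht hcase1 hcase2)
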